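/- Let n, J be natural numbers, let y ∈ ℝⁿ, let λ > 0, and let K₁, …, K_J be n×n real symmetric positive semidefinite matrices. Set S'ⱼ := Kⱼ(Kⱼ + λIₙ)⁻¹ for each j, and define S₁, …, S_J recursively by Sⱼ := S'ⱼ(Iₙ − Σ_{l=1}^{j−1} S_l) (so S₁ = S'₁). Define residual vectors recursively by ỹ₁ := y and ỹ_{j+1} := ỹⱼ − S'ⱼ ỹⱼ. Then the cumulative stagewise fit equals the linear smoother applied to y: Σ_{j=1}^{J} S'ⱼ ỹⱼ = (Σ_{j=1}^{J} Sⱼ) y. (Theorem 1 of the paper: under a squared loss, the additive subspace-based estimate ŷ is the linear projection ŷ = S y with S = Σⱼ Sⱼ.) -/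

import Mathlib

open Matrix Finset

/-- The residual after `k` stages of fitting is `y` minus the linear smoother applied to `y`. -/
theorem stagewise_residual_eq {ι R : Type*} [Fintype ι] [DecidableEq ι] [Ring R]
    {J : ℕ} {S' S : ℕ → Matrix ι ι R} {r : ℕ → ι → R}
    (hS : ∀ j ∈ Icc 1 J, S j = S' j * (1 - ∑ l ∈ Icc 1 (j - 1), S l))
    (hr : ∀ j ∈ Icc 1 J, r (j + 1) = r j - S' j *ᵥ r j) {k : ℕ} (hk : k ≤ J) :
    r (k + 1) = (1 - ∑ l ∈ Icc 1 k, S l) *ᵥ r 1 := by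
  induction k with
  | zero => simp
  | succ k ih =>
    have hmem : k + 1 ∈ Icc 1 J := by simp [hk]
    rw [hr _ hmem, sum_Icc_succ_top (by omega), ← sub_sub, sub_mulVec _ (S (k + 1)), hS _ hmem,
      ih (by omega), mulVec_mulVec, Nat.add_sub_cancel]

/-- Theorem 1 of the paper: under a squared loss, the additive subspace-based
estimate is the linear smoother `ŷ = S y` with `S = ∑ⱼ Sⱼ`.  Here
`S'ⱼ = Kⱼ (Kⱼ + λ Iₙ)⁻¹` is the per-stage ridge smoother,
`Sⱼ = S'ⱼ (Iₙ − ∑_{l=1}^{j-1} S_l)` (so `S₁ = S'₁`), the residuals satisfy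
`ỹ₁ = y`, `ỹ_{j+1} = ỹⱼ − S'ⱼ ỹⱼ`, and the claim is
`∑_{j=1}^J S'ⱼ ỹⱼ = (∑_{j=1}^J Sⱼ) y`. -/
theorem stagewise_ridge_fit_eq_linear_smoother
    (n J : ℕ) (y : Fin n → ℝ) (lam : ℝ) (hlam : 0 < lam)
    (K : ℕ → Matrix (Fin n) (Fin n) ℝ)
    (hK : ∀ j ∈ Finset.Icc 1 J, (K j).PosSemidef)
    (S' S : ℕ → Matrix (Fin n) (Fin n) ℝ)
    (hS' : ∀ j ∈ Finset.Icc 1 J, S' j = K j * (K j + lam • (1 : Matrix (Fin n) (Fin n) ℝ))⁻¹)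
    (hS : ∀ j ∈ Finset.Icc 1 J,
      S j = S' j * ((1 : Matrix (Fin n) (Fin n) ℝ) - ∑ l ∈ Finset.Icc 1 (j - 1), S l))
    (yt : ℕ → Fin n → ℝ)
    (hyt1 : yt 1 = y)
    (hyt : ∀ j ∈ Finset.Icc 1 J, yt (j + 1) = yt j - (S' j).mulVec (yt j)) :
    ∑ j ∈ Finset.Icc 1 J, (S' j).mulVec (yt j)
      = (∑ j ∈ Finset.Icc 1 J, S j).mulVec y := by
  rw [sum_mulVec]
  refine sum_congr rfl fun j hj => ?_
  obtain ⟨h1, hJ⟩ := mem_Icc.mp hj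
  have hres := stagewise_residual_eq hS hyt (k := j - 1) (by omega)
  rw [Nat.sub_add_cancel h1, hyt1] at hres
  rw [hres, mulVec_mulVec, ← hS j hj]
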